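/- arXiv:1508.07734 — 3 statements merged into one kernel-verified Lean document; each statement's English description precedes it below -/
import Mathlib

section
/- Let X be a Tychonoff (completely regular Hausdorff) space and let 𝔍 be an ideal in X with respect to which X is locally null. Then: (a) C^𝔍_0(X) is a closed ideal of C_B(X) containing C^𝔍_00(X); (b) λ_𝔍X is an open subspace of βX (hence locally compact Hausdorff) containing X as a dense subspace; (c) the map sending f ∈ C^𝔍_0(X) to the restriction of f_β to λ_𝔍X is an isometric isomorphism of C^𝔍_0(X) onto C_0(λ_𝔍X); (d) C^𝔍_0(X) has a multiplicative unit if and only if X ∈ 𝔍, if and only if λ_𝔍X is compact; (e) if X is moreover normal, then C^𝔍_00(X) is dense in C^𝔍_0(X) in the norm topology. -/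
open Set Filter Topology BoundedContinuousFunction

noncomputable section

/-- A (set-theoretic) ideal in a set `X`: a nonempty collection of subsets of `X` closed under
taking subsets and finite unions. -/
def IsSetIdeal {X : Type*} (I : Set (Set X)) : Prop :=
  I.Nonempty ∧ (∀ A B : Set X, A ⊆ B → B ∈ I → A ∈ I) ∧
    ∀ A B : Set X, A ∈ I → B ∈ I → A ∪ B ∈ I

/-- `A` has a null (i.e. member of `I`) neighborhood in `X`. -/
def HasNullNbhd {X : Type*} [TopologicalSpace X] (I : Set (Set X)) (A : Set X) : Prop :=
  ∃ U ∈ I, A ⊆ interior U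

/-- A cozero-set of `X`. -/
def IsCozeroSet {X : Type*} [TopologicalSpace X] (C : Set X) : Prop :=
  ∃ g : C(X, ℝ), C = {x | g x ≠ 0}

/-- `C^𝔍_00(X)`: bounded continuous functions whose support has a null neighborhood. -/
def CI00 (X : Type*) [TopologicalSpace X] (I : Set (Set X)) : Set (X →ᵇ ℂ) :=
  {f | HasNullNbhd I (closure {x | f x ≠ 0})}

/-- `C^𝔍_0(X)`: bounded continuous functions `f` with `{x : |f x| ≥ 1/n}` null for all `n ≥ 1`. -/
def CI0 (X : Type*) [TopologicalSpace X] (I : Set (Set X)) : Set (X →ᵇ ℂ) :=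
  {f | ∀ n : ℕ, 0 < n → {x | (1 : ℝ) / n ≤ ‖f x‖} ∈ I}

/-- The subspace `λ_𝔍X` of the Stone–Čech compactification `βX`. -/
def lambdaSet (X : Type*) [TopologicalSpace X] (I : Set (Set X)) : Set (StoneCech X) :=
  ⋃ C ∈ {C : Set X | IsCozeroSet C ∧ HasNullNbhd I (closure C)},
    interior (closure (stoneCechUnit '' C))

namespace IsSetIdeal

variable {X : Type*} {I : Set (Set X)}

theorem mono (hI : IsSetIdeal I) {A B : Set X} (h : A ⊆ B) (hB : B ∈ I) : A ∈ I :=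
  hI.2.1 A B h hB

theorem empty_mem (hI : IsSetIdeal I) : ∅ ∈ I :=
  let ⟨_, hA⟩ := hI.1
  hI.mono (empty_subset _) hA

theorem union_mem (hI : IsSetIdeal I) {A B : Set X} (hA : A ∈ I) (hB : B ∈ I) : A ∪ B ∈ I :=
  hI.2.2 A B hA hB

end IsSetIdeal

section

variable {X : Type*} [TopologicalSpace X] {I : Set (Set X)}

theorem mem_CI0_iff (hI : IsSetIdeal I) {f : X →ᵇ ℂ} :
    f ∈ CI0 X I ↔ ∀ ε : ℝ, 0 < ε → {x | ε ≤ ‖f x‖} ∈ I := by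
  refine ⟨fun hf ε hε => ?_, fun hf n hn => hf _ (by positivity)⟩
  obtain ⟨n, hn⟩ := exists_nat_one_div_lt hε
  refine hI.mono (fun x hx => ?_) (hf (n + 1) n.succ_pos)
  push_cast
  exact hn.le.trans hx

theorem zero_mem_CI0 (hI : IsSetIdeal I) : (0 : X →ᵇ ℂ) ∈ CI0 X I := by
  refine (mem_CI0_iff hI).2 fun ε hε => hI.mono (fun x hx => ?_) hI.empty_mem
  simp only [mem_ofPred_eq, BoundedContinuousFunction.coe_zero, Pi.zero_apply, norm_zero] at hx
  exact absurd hx (not_le.2 hε)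

theorem add_mem_CI0 (hI : IsSetIdeal I) {f g : X →ᵇ ℂ} (hf : f ∈ CI0 X I) (hg : g ∈ CI0 X I) :
    f + g ∈ CI0 X I := by
  rw [mem_CI0_iff hI] at *
  refine fun ε hε => hI.mono (fun x hx => ?_)
    (hI.union_mem (hf _ (half_pos hε)) (hg _ (half_pos hε)))
  have h : ε ≤ ‖f x + g x‖ := hx
  have := norm_add_le (f x) (g x)
  by_contra hcon
  simp only [mem_union, mem_ofPred_eq, not_or, not_le] at hcon
  linarith

theorem mul_mem_CI0 (hI : IsSetIdeal I) (g : X →ᵇ ℂ) {f : X →ᵇ ℂ} (hf : f ∈ CI0 X I) :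
    g * f ∈ CI0 X I := by
  rw [mem_CI0_iff hI] at *
  intro ε hε
  have hg : 0 < ‖g‖ + 1 := by positivity
  refine hI.mono (fun x hx => ?_) (hf (ε / (‖g‖ + 1)) (by positivity))
  have h : ε ≤ ‖g x * f x‖ := hx
  rw [norm_mul] at h
  rw [mem_ofPred_eq, div_le_iff₀ hg]
  nlinarith [g.norm_coe_le_norm x, norm_nonneg (f x)]

theorem isClosed_CI0 (hI : IsSetIdeal I) : IsClosed (CI0 X I) := by
  refine isClosed_of_closure_subset fun f hf => (mem_CI0_iff hI).2 fun ε hε => ?_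
  obtain ⟨g, hg, hfg⟩ := Metric.mem_closure_iff.1 hf (ε / 2) (half_pos hε)
  refine hI.mono (fun x hx => ?_) ((mem_CI0_iff hI).1 hg _ (half_pos hε))
  have h1 : ε ≤ ‖f x‖ := hx
  have h2 := (BoundedContinuousFunction.dist_coe_le_dist (f := f) (g := g) x).trans_lt hfg
  rw [dist_eq_norm] at h2
  have h3 := norm_sub_norm_le (f x) (g x)
  rw [mem_ofPred_eq]
  linarith

theorem CI00_subset_CI0 (hI : IsSetIdeal I) : CI00 X I ⊆ CI0 X I := by
  rintro f ⟨U, hU, hfU⟩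
  refine (mem_CI0_iff hI).2 fun ε hε => hI.mono (fun x hx => ?_) hU
  exact interior_subset (hfU (subset_closure (norm_pos_iff.1 (hε.trans_le hx))))

theorem setOf_le_norm_subset_interior (f : X →ᵇ ℂ) {δ ε : ℝ} (h : δ < ε) :
    {x | ε ≤ ‖f x‖} ⊆ interior {x | δ ≤ ‖f x‖} := by
  have ho : IsOpen {x | δ < ‖f x‖} := isOpen_lt continuous_const f.continuous.norm
  exact fun x hx => interior_maximal (fun y (hy : δ < ‖f y‖) => hy.le) ho (h.trans_le hx)

theorem CI0_subset_closure_CI00 (hI : IsSetIdeal I) : CI0 X I ⊆ closure (CI00 X I) := by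
  intro f hf
  refine Metric.mem_closure_iff.2 fun ε hε => ?_
  -- Multiply `f` by a cutoff that vanishes for `‖f‖ ≤ ε / 4` and equals one for `‖f‖ ≥ ε / 2`.
  let φ : X → ℝ := fun x => min 1 (max 0 (4 / ε * ‖f x‖ - 1))
  have hφ0 : ∀ x, 0 ≤ φ x := fun x => le_min zero_le_one (le_max_left _ _)
  have hφ1 : ∀ x, φ x ≤ 1 := fun x => min_le_left _ _
  have hφc : Continuous fun x => (φ x : ℂ) := by fun_prop
  let p : X →ᵇ ℂ := BoundedContinuousFunction.ofNormedAddCommGroup (fun x => (φ x : ℂ)) hφc 1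
    fun x => by
      rw [Complex.norm_real, Real.norm_of_nonneg (hφ0 x)]
      exact hφ1 x
  refine ⟨p * f, ⟨_, (mem_CI0_iff hI).1 hf (ε / 8) (by positivity), ?_⟩, ?_⟩
  · refine Subset.trans (closure_minimal (fun x hx => ?_) ?_)
      (setOf_le_norm_subset_interior f (show ε / 8 < ε / 4 by linarith))
    · by_contra hlt
      rw [mem_ofPred_eq, not_le] at hlt
      have hφx : φ x = 0 := by
        have : 4 / ε * ‖f x‖ ≤ 4 / ε * (ε / 4) := by gcongr
        have h1 : 4 / ε * (ε / 4) = 1 := by field_simp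
        simp only [φ]
        rw [max_eq_left (by linarith), min_eq_right zero_le_one]
      exact hx (show (φ x : ℂ) * f x = 0 by simp [hφx])
    · exact isClosed_le continuous_const f.continuous.norm
  · refine lt_of_le_of_lt ((BoundedContinuousFunction.dist_le (half_pos hε).le).2 fun x => ?_)
      (half_lt_self hε)
    have heq : f x - (p * f) x = ((1 - φ x : ℝ) : ℂ) * f x := by
      change f x - (φ x : ℂ) * f x = _
      push_cast
      ring
    rw [dist_eq_norm, heq, norm_mul, Complex.norm_real,
      Real.norm_of_nonneg (sub_nonneg.2 (hφ1 x))]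
    rcases le_total ‖f x‖ (ε / 2) with h | h
    · nlinarith [hφ0 x, norm_nonneg (f x)]
    · have hφx : φ x = 1 := by
        have : 4 / ε * (ε / 2) ≤ 4 / ε * ‖f x‖ := by gcongr
        have h1 : 4 / ε * (ε / 2) = 2 := by field_simp; norm_num
        exact min_eq_left (le_max_of_le_right (by linarith))
      rw [hφx, sub_self, zero_mul]
      positivity

theorem exists_mem_CI0_ne_zero [CompletelyRegularSpace X] (hI : IsSetIdeal I)
    (hloc : ∀ x : X, ∃ U ∈ I, x ∈ interior U) (x : X) : ∃ f ∈ CI0 X I, f x ≠ 0 := by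
  obtain ⟨U, hU, hxU⟩ := hloc x
  obtain ⟨h, hc, hx, hK⟩ := CompletelyRegularSpace.completely_regular x (interior U)ᶜ
    isOpen_interior.isClosed_compl (not_not.2 hxU)
  refine ⟨BoundedContinuousFunction.ofNormedAddCommGroup (fun y => ((1 - (h y : ℝ) : ℝ) : ℂ))
    (by fun_prop) 1 fun y => ?_, (mem_CI0_iff hI).2 fun ε hε => hI.mono (fun y hy => ?_) hU, ?_⟩
  · rw [Complex.norm_real, Real.norm_of_nonneg (sub_nonneg.2 (h y).2.2)]
    linarith [(h y).2.1]
  · by_contra hyU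
    have hhy : h y = 1 := hK fun hy' => hyU (interior_subset hy')
    have : ε ≤ ‖((1 - (h y : ℝ) : ℝ) : ℂ)‖ := hy
    rw [hhy] at this
    simp only [Set.Icc.coe_one, sub_self, Complex.ofReal_zero, norm_zero] at this
    linarith
  · change ((1 - (h x : ℝ) : ℝ) : ℂ) ≠ 0
    simp [hx]

/-- Every bounded continuous function extends continuously to the Stone–Čech compactification. -/
theorem exists_stoneCech_extension (f : X →ᵇ ℂ) :
    ∃ F : C(StoneCech X, ℂ), ∀ x, F (stoneCechUnit x) = f x := by
  let g : X → Metric.closedBall (0 : ℂ) ‖f‖ :=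
    fun x => ⟨f x, mem_closedBall_zero_iff.2 (f.norm_coe_le_norm x)⟩
  have hg : Continuous g := f.continuous.subtype_mk _
  have : CompactSpace (Metric.closedBall (0 : ℂ) ‖f‖) :=
    isCompact_iff_compactSpace.1 (isCompact_closedBall _ _)
  exact ⟨⟨fun y => (stoneCechExtend hg y).1,
    continuous_subtype_val.comp (continuous_stoneCechExtend hg)⟩,
    fun x => congrArg Subtype.val (stoneCechExtend_stoneCechUnit hg x)⟩

theorem isOpen_lambdaSet : IsOpen (lambdaSet X I) :=
  isOpen_biUnion fun _ _ => isOpen_interior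

theorem mem_lambdaSet_of_ne_zero (hI : IsSetIdeal I) {f : X →ᵇ ℂ} (hf : f ∈ CI0 X I)
    {F : C(StoneCech X, ℂ)} (hF : ∀ x, F (stoneCechUnit x) = f x) {y : StoneCech X}
    (hy : F y ≠ 0) : y ∈ lambdaSet X I := by
  set ε := ‖F y‖ / 2 with hε
  have hpos : 0 < ‖F y‖ := norm_pos_iff.2 hy
  have hε0 : 0 < ε := half_pos hpos
  let C : Set X := {x | ε < ‖f x‖}
  have hC : IsCozeroSet C := by
    refine ⟨⟨fun x => max 0 (‖f x‖ - ε), by fun_prop⟩, Set.ext fun x => ?_⟩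
    change ε < ‖f x‖ ↔ max 0 (‖f x‖ - ε) ≠ 0
    rw [ne_eq, max_eq_left_iff, not_le, sub_pos]
  have hcl : HasNullNbhd I (closure C) := by
    refine ⟨_, (mem_CI0_iff hI).1 hf _ (half_pos hε0), Subset.trans (closure_minimal ?_ ?_)
      (setOf_le_norm_subset_interior f (half_lt_self hε0))⟩
    · exact fun x (hx : ε < ‖f x‖) => hx.le
    · exact isClosed_le continuous_const f.continuous.norm
  refine mem_biUnion (show C ∈ {C : Set X | _} from ⟨hC, hcl⟩) ?_
  have hV : IsOpen {z | ε < ‖F z‖} := isOpen_lt continuous_const F.continuous.norm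
  refine interior_maximal (fun z hz => ?_) hV (half_lt_self hpos)
  refine closure_mono ?_ (denseRange_stoneCechUnit.open_subset_closure_inter hV hz)
  rintro _ ⟨hw, x, rfl⟩
  exact ⟨x, by simpa only [C, mem_ofPred_eq, hF] using hw, rfl⟩

theorem range_stoneCechUnit_subset_lambdaSet [CompletelyRegularSpace X] (hI : IsSetIdeal I)
    (hloc : ∀ x : X, ∃ U ∈ I, x ∈ interior U) :
    range (stoneCechUnit : X → StoneCech X) ⊆ lambdaSet X I := by
  rintro _ ⟨x, rfl⟩
  obtain ⟨f, hf, hx⟩ := exists_mem_CI0_ne_zero hI hloc x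
  obtain ⟨F, hF⟩ := exists_stoneCech_extension f
  exact mem_lambdaSet_of_ne_zero hI hf hF (by rwa [hF])

/-- The trace on `X` of a compact subset of `λ_𝔍X` is null. -/
theorem preimage_mem_of_isCompact [CompletelyRegularSpace X] (hI : IsSetIdeal I)
    {K : Set (StoneCech X)} (hK : IsCompact K) (hKl : K ⊆ lambdaSet X I) :
    stoneCechUnit ⁻¹' K ∈ I := by
  refine hK.induction_on (p := fun s => stoneCechUnit ⁻¹' s ∈ I) hI.empty_mem
    (fun s t hst ht => hI.mono (preimage_mono hst) ht) (fun s t hs ht => hI.union_mem hs ht)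
    fun y hy => ?_
  obtain ⟨C, ⟨-, U, hU, hCU⟩, hyC⟩ := mem_iUnion₂.1 (hKl hy)
  refine ⟨_, mem_nhdsWithin_of_mem_nhds (isOpen_interior.mem_nhds hyC), hI.mono (fun x hx => ?_) hU⟩
  refine interior_subset (hCU ?_)
  rw [isInducing_stoneCechUnit.closure_eq_preimage_closure_image]
  exact interior_subset (s := closure (stoneCechUnit '' C)) hx

theorem dense_lambdaSet : Dense {y : lambdaSet X I |
    (y : StoneCech X) ∈ range (stoneCechUnit : X → StoneCech X)} :=
  denseRange_stoneCechUnit.preimage isOpen_lambdaSet.isOpenMap_subtype_val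

theorem lambdaSet_boundedContinuousFunction_ext {f g : lambdaSet X I →ᵇ ℂ}
    (h : ∀ (x : X) (hx : stoneCechUnit x ∈ lambdaSet X I),
      f ⟨stoneCechUnit x, hx⟩ = g ⟨stoneCechUnit x, hx⟩) : f = g := by
  refine DFunLike.coe_injective (Continuous.ext_on dense_lambdaSet f.continuous g.continuous ?_)
  rintro ⟨_, hy⟩ ⟨x, rfl⟩
  exact h x hy

end

theorem stmt_1 {X : Type*} [TopologicalSpace X] [T35Space X]
    (𝔍 : Set (Set X)) (hI : IsSetIdeal 𝔍)
    (hloc : ∀ x : X, ∃ U ∈ 𝔍, x ∈ interior U) :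
    -- (a) `C^𝔍_0(X)` is a closed ideal of `C_B(X)` containing `C^𝔍_00(X)`
    ((∃ I : Ideal (X →ᵇ ℂ), (I : Set (X →ᵇ ℂ)) = CI0 X 𝔍) ∧
      IsClosed (CI0 X 𝔍) ∧ CI00 X 𝔍 ⊆ CI0 X 𝔍) ∧
    -- (b) `λ_𝔍X` is open in `βX` and contains `X` as a dense subspace
    (IsOpen (lambdaSet X 𝔍) ∧
      Set.range (stoneCechUnit : X → StoneCech X) ⊆ lambdaSet X 𝔍 ∧
      Dense {y : ↥(lambdaSet X 𝔍) |
        (y : StoneCech X) ∈ Set.range (stoneCechUnit : X → StoneCech X)}) ∧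
    -- (c) `f ↦ f_β|_{λ_𝔍X}` is an isometric isomorphism of `C^𝔍_0(X)` onto `C_0(λ_𝔍X)`
    (∃ Φ : (X →ᵇ ℂ) → (↥(lambdaSet X 𝔍) →ᵇ ℂ),
      (∀ f ∈ CI0 X 𝔍, ∀ (x : X) (hx : stoneCechUnit x ∈ lambdaSet X 𝔍),
        Φ f ⟨stoneCechUnit x, hx⟩ = f x) ∧
      (∀ f ∈ CI0 X 𝔍,
        Filter.Tendsto (Φ f : ↥(lambdaSet X 𝔍) → ℂ) (Filter.cocompact _) (nhds 0)) ∧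
      (∀ g : ↥(lambdaSet X 𝔍) →ᵇ ℂ,
        Filter.Tendsto (g : ↥(lambdaSet X 𝔍) → ℂ) (Filter.cocompact _) (nhds 0) →
        ∃ f ∈ CI0 X 𝔍, Φ f = g) ∧
      (∀ f ∈ CI0 X 𝔍, ∀ g ∈ CI0 X 𝔍, Φ f = Φ g → f = g) ∧
      (∀ f ∈ CI0 X 𝔍, ∀ g ∈ CI0 X 𝔍, Φ (f + g) = Φ f + Φ g) ∧
      (∀ f ∈ CI0 X 𝔍, ∀ g ∈ CI0 X 𝔍, Φ (f * g) = Φ f * Φ g) ∧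
      (∀ (c : ℂ), ∀ f ∈ CI0 X 𝔍, Φ (c • f) = c • Φ f) ∧
      (∀ f ∈ CI0 X 𝔍, ‖Φ f‖ = ‖f‖)) ∧
    -- (d) unit iff `X ∈ 𝔍` iff `λ_𝔍X` compact
    ((∃ u ∈ CI0 X 𝔍, ∀ f ∈ CI0 X 𝔍, u * f = f) ↔ Set.univ ∈ 𝔍) ∧
    (Set.univ ∈ 𝔍 ↔ IsCompact (lambdaSet X 𝔍)) ∧
    -- (e) if `X` is normal then `C^𝔍_00(X)` is dense in `C^𝔍_0(X)`
    (NormalSpace X → CI0 X 𝔍 ⊆ closure (CI00 X 𝔍)) := by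
  have hr := range_stoneCechUnit_subset_lambdaSet hI hloc
  have hmem : ∀ x : X, stoneCechUnit x ∈ lambdaSet X 𝔍 := fun x => hr (mem_range_self x)
  refine ⟨⟨⟨{ carrier := CI0 X 𝔍
              add_mem' := add_mem_CI0 hI
              zero_mem' := zero_mem_CI0 hI
              smul_mem' := fun c _ hf => mul_mem_CI0 hI c hf }, rfl⟩,
    isClosed_CI0 hI, CI00_subset_CI0 hI⟩, ⟨isOpen_lambdaSet, hr, dense_lambdaSet⟩,
    ?_, ⟨?_, ?_⟩, ⟨?_, ?_⟩, fun _ => CI0_subset_closure_CI00 hI⟩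
  · choose E hE using fun f : X →ᵇ ℂ => exists_stoneCech_extension f
    let Φ : (X →ᵇ ℂ) → (lambdaSet X 𝔍 →ᵇ ℂ) := fun f =>
      (BoundedContinuousFunction.mkOfCompact (E f)).compContinuous ⟨_, continuous_subtype_val⟩
    have hΦ : ∀ f x, Φ f ⟨stoneCechUnit x, hmem x⟩ = f x := hE
    refine ⟨Φ, fun f _ x _ => hΦ f x, fun f hf => ?_, fun g hg => ?_, fun f _ g _ hfg => ?_,
      fun f _ g _ => ?_, fun f _ g _ => ?_, fun c f _ => ?_, fun f _ => ?_⟩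
    · rw [Metric.tendsto_nhds]
      intro ε hε
      have hK : IsCompact {y | ε ≤ ‖E f y‖} :=
        (isClosed_le continuous_const (E f).continuous.norm).isCompact
      have hsub : {y | ε ≤ ‖E f y‖} ⊆ range (Subtype.val : lambdaSet X 𝔍 → StoneCech X) := by
        rw [Subtype.range_coe]
        exact fun y hy => mem_lambdaSet_of_ne_zero hI hf (hE f)
          (norm_pos_iff.1 (hε.trans_le hy))
      have hK' := (Topology.IsInducing.subtypeVal.isCompact_preimage_iff hsub).2 hK
      filter_upwards [hK'.compl_mem_cocompact] with y hy
      rw [dist_zero_right]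
      exact not_le.1 hy
    · refine ⟨g.compContinuous ⟨fun x => ⟨stoneCechUnit x, hmem x⟩,
        continuous_stoneCechUnit.subtype_mk _⟩, (mem_CI0_iff hI).2 fun ε hε => ?_,
        lambdaSet_boundedContinuousFunction_ext fun x _ => hΦ _ x⟩
      obtain ⟨K, hK, hKg⟩ := mem_cocompact.1 (hg (Metric.ball_mem_nhds 0 hε))
      refine hI.mono (fun x hx => ?_) (preimage_mem_of_isCompact hI
        (hK.image continuous_subtype_val) (Subtype.coe_image_subset _ K))
      refine ⟨⟨stoneCechUnit x, hmem x⟩, by_contra fun hxK => ?_, rfl⟩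
      exact not_lt.2 hx (mem_ball_zero_iff.1 (hKg hxK))
    · ext x
      rw [← hΦ f, hfg, hΦ]
    · refine lambdaSet_boundedContinuousFunction_ext fun x _ => ?_
      simp only [BoundedContinuousFunction.coe_add, Pi.add_apply, hΦ]
    · refine lambdaSet_boundedContinuousFunction_ext fun x _ => ?_
      simp only [BoundedContinuousFunction.coe_mul, Pi.mul_apply, hΦ]
    · refine lambdaSet_boundedContinuousFunction_ext fun x _ => ?_
      simp only [BoundedContinuousFunction.coe_smul, hΦ]
    · refine le_antisymm ?_ ((BoundedContinuousFunction.norm_le (norm_nonneg _)).2 fun x => ?_)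
      · refine (BoundedContinuousFunction.norm_le (norm_nonneg _)).2 fun y => ?_
        have hcl : IsClosed {z | ‖E f z‖ ≤ ‖f‖} :=
          isClosed_le (E f).continuous.norm continuous_const
        refine denseRange_stoneCechUnit.induction_on (p := fun z => ‖E f z‖ ≤ ‖f‖) y.1 hcl
          fun x => ?_
        rw [hE]
        exact f.norm_coe_le_norm x
      · rw [← hΦ f x]
        exact (Φ f).norm_coe_le_norm _
  · rintro ⟨u, hu, hunit⟩
    refine hI.mono (fun x _ => ?_) ((mem_CI0_iff hI).1 hu 1 one_pos)
    obtain ⟨f, hf, hx⟩ := exists_mem_CI0_ne_zero hI hloc x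
    have hux : u x = 1 := mul_right_cancel₀ hx
      ((DFunLike.congr_fun (hunit f hf) x).trans (one_mul _).symm)
    rw [mem_ofPred_eq, hux, norm_one]
  · exact fun h => ⟨1, fun _ _ => hI.mono (subset_univ _) h, fun f _ => one_mul f⟩
  · intro h
    have huniv : lambdaSet X 𝔍 = univ := by
      refine eq_univ_of_forall fun y => ?_
      exact mem_lambdaSet_of_ne_zero hI (f := 1) (F := 1)
        (fun _ _ => hI.mono (subset_univ _) h) (fun _ => rfl) (y := y) one_ne_zero
    rw [huniv]
    exact isCompact_univ
  · intro h
    exact hI.mono (fun x _ => hmem x) (preimage_mem_of_isCompact hI h subset_rfl)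
end
end

section
/- Let 𝔰_00 = { x ∈ ℓ∞ : the series ∑ 1/n over {n ∈ ℕ : x(n) ≠ 0} converges }. Then: (1) 𝔰_00 is an ideal of the algebra ℓ∞; (2) 𝔰_00 has no multiplicative unit; (3) setting S = ⋃{ cl_{βℕ}A : A ⊆ ℕ and ∑_{n∈A} 1/n converges } ⊆ βℕ, the set S is open in βℕ, contains ℕ as a dense subspace, is not compact, and 𝔰_00 is isometrically isomorphic to C_00(S). -/
open Set Filter Topology BoundedContinuousFunction

noncomputable section

/-- `A ⊆ ℕ` is small: `∑_{n ∈ A} 1/n` converges. -/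
def SummableOver (A : Set ℕ) : Prop :=
  Summable fun n : A => (1 : ℝ) / ((n : ℕ) : ℝ)

/-- The summable ideal `𝔰_00` in `ℓ∞ = C_B(ℕ)`. -/
def s00 : Set (ℕ →ᵇ ℂ) :=
  {x | SummableOver {n : ℕ | x n ≠ 0}}

/-- The subspace `S` of `βℕ`. -/
def Sset : Set (StoneCech ℕ) :=
  ⋃ A ∈ {A : Set ℕ | SummableOver A}, closure (stoneCechUnit '' A)

theorem summableOver_iff_indicator {A : Set ℕ} :
    SummableOver A ↔ Summable (A.indicator fun n : ℕ => (1 : ℝ) / (n : ℝ)) :=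
  summable_subtype_iff_indicator (f := fun n : ℕ => (1 : ℝ) / (n : ℝ))

theorem SummableOver.mono {A B : Set ℕ} (hB : SummableOver B) (h : A ⊆ B) : SummableOver A := by
  rw [summableOver_iff_indicator] at *
  exact Summable.of_nonneg_of_le (fun n => Set.indicator_nonneg (fun _ _ => by positivity) n)
    (Set.indicator_le_indicator_of_subset h fun _ => by positivity) hB

theorem SummableOver.union {A B : Set ℕ} (hA : SummableOver A) (hB : SummableOver B) :
    SummableOver (A ∪ B) := by
  rw [summableOver_iff_indicator] at *
  refine Summable.of_nonneg_of_le (fun n => Set.indicator_nonneg (fun _ _ => by positivity) n)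
    (fun n => ?_) (hA.add hB)
  have h : (0 : ℝ) ≤ 1 / (n : ℝ) := by positivity
  by_cases h₁ : n ∈ A <;> by_cases h₂ : n ∈ B <;> simp [h₁, h₂]

theorem Set.Finite.summableOver {A : Set ℕ} (hA : A.Finite) : SummableOver A := by
  have := hA.to_subtype
  exact Summable.of_finite

theorem not_summableOver_univ : ¬ SummableOver Set.univ := by
  rw [summableOver_iff_indicator, Set.indicator_univ]
  exact Real.not_summable_one_div_natCast

/-- The summable ideal as a bundled ideal of `ℓ∞`. -/
def summableIdeal : Ideal (ℕ →ᵇ ℂ) where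
  carrier := s00
  zero_mem' := Set.Finite.summableOver (by simp)
  add_mem' {f g} hf hg := by
    refine SummableOver.mono (SummableOver.union hf hg) fun n hn => ?_
    by_contra h
    simp only [Set.mem_union, Set.mem_ofPred_eq, not_or, not_not] at h
    exact hn (by simp [h.1, h.2])
  smul_mem' c f hf := by
    refine SummableOver.mono hf fun n hn h => hn ?_
    simp [h]

theorem not_exists_unit_s00 : ¬ ∃ u ∈ s00, ∀ f ∈ s00, u * f = f := by
  rintro ⟨u, hu, h⟩
  refine not_summableOver_univ (SummableOver.mono hu fun n _ hn => ?_)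
  let f : ℕ →ᵇ ℂ := BoundedContinuousFunction.ofNormedAddCommGroup
    (Pi.single n (1 : ℂ)) continuous_of_discreteTopology 1 fun m => by
      by_cases hm : m = n
      · subst hm; simp
      · simp [hm]
  have hf : f ∈ s00 := by
    refine Set.Finite.summableOver ((Set.finite_singleton n).subset fun m hm => ?_)
    by_contra hmn
    exact hm (Pi.single_eq_of_ne hmn _)
  have hfn : f n = 1 := Pi.single_eq_same (M := fun _ : ℕ => ℂ) n 1
  have := congrArg (fun g : ℕ →ᵇ ℂ => g n) (h f hf)
  simp [hn, hfn] at this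

theorem exists_isClopen_preimage_stoneCechUnit (A : Set ℕ) :
    ∃ C : Set (StoneCech ℕ), IsClopen C ∧ stoneCechUnit ⁻¹' C = A := by
  classical
  have hc : Continuous fun n : ℕ => decide (n ∈ A) := continuous_of_discreteTopology
  refine ⟨stoneCechExtend hc ⁻¹' {true},
    (isClopen_discrete _).preimage (continuous_stoneCechExtend hc), ?_⟩
  ext n
  simp [stoneCechExtend_stoneCechUnit]

theorem IsOpen.subset_closure_image_stoneCechUnit {U : Set (StoneCech ℕ)} (hU : IsOpen U) :
    U ⊆ closure (stoneCechUnit '' (stoneCechUnit ⁻¹' U)) := by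
  rw [Set.image_preimage_eq_inter_range]
  exact denseRange_stoneCechUnit.open_subset_closure_inter hU

theorem isClopen_closure_image_stoneCechUnit (A : Set ℕ) :
    IsClopen (closure (stoneCechUnit '' A : Set (StoneCech ℕ))) ∧
      stoneCechUnit ⁻¹' closure (stoneCechUnit '' A) = A := by
  obtain ⟨C, hC, rfl⟩ := exists_isClopen_preimage_stoneCechUnit A
  have : closure (stoneCechUnit '' (stoneCechUnit ⁻¹' C)) = C :=
    (closure_minimal (Set.image_preimage_subset _ _) hC.isClosed).antisymm
      hC.isOpen.subset_closure_image_stoneCechUnit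
  rw [this]
  exact ⟨hC, rfl⟩

theorem closure_subset_Sset {A : Set ℕ} (hA : SummableOver A) :
    closure (stoneCechUnit '' A) ⊆ Sset :=
  Set.subset_biUnion_of_mem (u := fun A : Set ℕ => closure (stoneCechUnit '' A)) hA

theorem isOpen_Sset : IsOpen Sset :=
  isOpen_biUnion fun A _ => (isClopen_closure_image_stoneCechUnit A).1.isOpen

theorem stoneCechUnit_mem_Sset (n : ℕ) : stoneCechUnit n ∈ Sset :=
  closure_subset_Sset (Set.finite_singleton n).summableOver
    (subset_closure (Set.mem_image_of_mem _ rfl))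

theorem dense_Sset_range_stoneCechUnit :
    Dense {y : ↥Sset | (y : StoneCech ℕ) ∈ Set.range (stoneCechUnit : ℕ → StoneCech ℕ)} :=
  Dense.preimage denseRange_stoneCechUnit isOpen_Sset.isOpenMap_subtype_val

theorem IsCompact.exists_summableOver_subset_closure {K : Set (StoneCech ℕ)} (hK : IsCompact K)
    (hKS : K ⊆ Sset) : ∃ A, SummableOver A ∧ K ⊆ closure (stoneCechUnit '' A) := by
  have : Nonempty {A : Set ℕ // SummableOver A} := ⟨⟨∅, Set.finite_empty.summableOver⟩⟩
  obtain ⟨A, hA⟩ := hK.elim_directed_cover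
    (fun A : {A : Set ℕ // SummableOver A} => closure (stoneCechUnit '' A.1))
    (fun A => (isClopen_closure_image_stoneCechUnit A.1).1.isOpen)
    (fun y hy => by
      obtain ⟨A, hA, hyA⟩ := Set.mem_iUnion₂.1 (hKS hy)
      exact Set.mem_iUnion.2 ⟨⟨A, hA⟩, hyA⟩)
    (fun A B => ⟨⟨A.1 ∪ B.1, A.2.union B.2⟩,
      closure_mono (Set.image_mono Set.subset_union_left),
      closure_mono (Set.image_mono Set.subset_union_right)⟩)
  exact ⟨A.1, A.2, hA⟩

theorem not_isCompact_Sset : ¬ IsCompact Sset := by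
  intro h
  obtain ⟨A, hA, hSA⟩ := h.exists_summableOver_subset_closure subset_rfl
  refine not_summableOver_univ (hA.mono fun n _ => ?_)
  rw [← (isClopen_closure_image_stoneCechUnit A).2]
  exact hSA (stoneCechUnit_mem_Sset n)

theorem exists_continuous_extension_stoneCech (f : ℕ →ᵇ ℂ) :
    ∃ F : C(StoneCech ℕ, ℂ), ∀ n, F (stoneCechUnit n) = f n := by
  have : CompactSpace (Metric.closedBall (0 : ℂ) ‖f‖) :=
    isCompact_iff_compactSpace.1 (isCompact_closedBall _ _)
  have hc : Continuous fun n : ℕ => (⟨f n, by simpa using f.norm_coe_le_norm n⟩ :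
    Metric.closedBall (0 : ℂ) ‖f‖) := continuous_of_discreteTopology
  exact ⟨⟨fun y => Subtype.val (stoneCechExtend hc y),
    continuous_subtype_val.comp (continuous_stoneCechExtend hc)⟩,
    fun n => congrArg Subtype.val (stoneCechExtend_stoneCechUnit hc n)⟩

/-- The continuous extension of a bounded sequence to the Stone–Čech compactification. -/
def stoneCechLift (f : ℕ →ᵇ ℂ) : C(StoneCech ℕ, ℂ) :=
  (exists_continuous_extension_stoneCech f).choose

theorem stoneCechLift_stoneCechUnit (f : ℕ →ᵇ ℂ) (n : ℕ) :
    stoneCechLift f (stoneCechUnit n) = f n :=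
  (exists_continuous_extension_stoneCech f).choose_spec n

/-- The restriction to `S` of the continuous extension of a bounded sequence. -/
def liftSset (f : ℕ →ᵇ ℂ) : ↥Sset →ᵇ ℂ :=
  (BoundedContinuousFunction.mkOfCompact (stoneCechLift f)).compContinuous
    ⟨Subtype.val, continuous_subtype_val⟩

/-- The inclusion of `ℕ` in `S`. -/
def unitSset (n : ℕ) : ↥Sset :=
  ⟨stoneCechUnit n, stoneCechUnit_mem_Sset n⟩

theorem denseRange_unitSset : DenseRange unitSset :=
  dense_Sset_range_stoneCechUnit.mono <| by
    rintro y ⟨n, hn⟩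
    exact ⟨n, Subtype.ext hn⟩

theorem liftSset_unitSset (f : ℕ →ᵇ ℂ) (n : ℕ) : liftSset f (unitSset n) = f n :=
  stoneCechLift_stoneCechUnit f n

theorem eq_of_forall_unitSset {g h : ↥Sset →ᵇ ℂ}
    (H : ∀ n, g (unitSset n) = h (unitSset n)) : g = h :=
  DFunLike.coe_injective
    (denseRange_unitSset.equalizer g.continuous h.continuous (funext H))

theorem norm_liftSset (f : ℕ →ᵇ ℂ) : ‖liftSset f‖ = ‖f‖ := by
  refine le_antisymm ((BoundedContinuousFunction.norm_le (norm_nonneg f)).2 fun y => ?_)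
    ((BoundedContinuousFunction.norm_le (norm_nonneg _)).2 fun n => ?_)
  · refine denseRange_unitSset.induction_on (p := fun y => ‖liftSset f y‖ ≤ ‖f‖) y
      (isClosed_le (liftSset f).continuous.norm continuous_const) fun n => ?_
    rw [liftSset_unitSset]
    exact f.norm_coe_le_norm n
  · rw [← liftSset_unitSset]
    exact (liftSset f).norm_coe_le_norm _

theorem hasCompactSupport_liftSset {f : ℕ →ᵇ ℂ} (hf : f ∈ s00) :
    HasCompactSupport (liftSset f : ↥Sset → ℂ) := by
  have hK : IsCompact ((Subtype.val : ↥Sset → StoneCech ℕ) ⁻¹'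
      closure (stoneCechUnit '' {n : ℕ | f n ≠ 0})) := by
    rw [Subtype.isCompact_iff, Subtype.image_preimage_coe,
      Set.inter_eq_right.2 (closure_subset_Sset hf)]
    exact isClosed_closure.isCompact
  refine HasCompactSupport.intro hK fun y hy => ?_
  by_contra hne
  have hU : IsOpen {z : StoneCech ℕ | stoneCechLift f z ≠ 0} :=
    isOpen_ne_fun (stoneCechLift f).continuous continuous_const
  refine hy (closure_mono (Set.image_mono fun n hn => ?_)
    (hU.subset_closure_image_stoneCechUnit (show (y : StoneCech ℕ) ∈ _ from hne)))
  exact (stoneCechLift_stoneCechUnit f n).symm.trans_ne hn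

theorem exists_liftSset_eq {g : ↥Sset →ᵇ ℂ} (hg : HasCompactSupport (g : ↥Sset → ℂ)) :
    ∃ f ∈ s00, liftSset f = g := by
  refine ⟨g.compContinuous ⟨unitSset, continuous_of_discreteTopology⟩, ?_,
    eq_of_forall_unitSset fun n => liftSset_unitSset _ n⟩
  obtain ⟨A, hA, hgA⟩ := IsCompact.exists_summableOver_subset_closure
    (IsCompact.image hg continuous_subtype_val) (Subtype.coe_image_subset _ _)
  refine SummableOver.mono hA fun n hn => ?_
  rw [← (isClopen_closure_image_stoneCechUnit A).2]
  exact hgA ⟨unitSset n, subset_tsupport _ hn, rfl⟩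

theorem stmt_4 :
    -- (1) `𝔰_00` is an ideal of `ℓ∞`
    (∃ I : Ideal (ℕ →ᵇ ℂ), (I : Set (ℕ →ᵇ ℂ)) = s00) ∧
    -- (2) `𝔰_00` has no multiplicative unit
    (¬ ∃ u ∈ s00, ∀ f ∈ s00, u * f = f) ∧
    -- (3) `S` is open in `βℕ`, contains `ℕ` densely, is not compact, and
    --     `𝔰_00` is isometrically isomorphic to `C_00(S)`
    (IsOpen Sset ∧
      Set.range (stoneCechUnit : ℕ → StoneCech ℕ) ⊆ Sset ∧
      Dense {y : ↥Sset |
        (y : StoneCech ℕ) ∈ Set.range (stoneCechUnit : ℕ → StoneCech ℕ)} ∧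
      ¬ IsCompact Sset ∧
      ∃ Φ : (ℕ →ᵇ ℂ) → (↥Sset →ᵇ ℂ),
        (∀ f ∈ s00, HasCompactSupport (Φ f : ↥Sset → ℂ)) ∧
        (∀ g : ↥Sset →ᵇ ℂ, HasCompactSupport (g : ↥Sset → ℂ) → ∃ f ∈ s00, Φ f = g) ∧
        (∀ f ∈ s00, ∀ g ∈ s00, Φ f = Φ g → f = g) ∧
        (∀ f ∈ s00, ∀ g ∈ s00, Φ (f + g) = Φ f + Φ g) ∧
        (∀ f ∈ s00, ∀ g ∈ s00, Φ (f * g) = Φ f * Φ g) ∧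
        (∀ (c : ℂ), ∀ f ∈ s00, Φ (c • f) = c • Φ f) ∧
        (∀ f ∈ s00, ‖Φ f‖ = ‖f‖)) := by
  refine ⟨⟨summableIdeal, rfl⟩, not_exists_unit_s00, isOpen_Sset,
    Set.range_subset_iff.2 stoneCechUnit_mem_Sset, dense_Sset_range_stoneCechUnit,
    not_isCompact_Sset, liftSset, fun _ => hasCompactSupport_liftSset,
    fun _ => exists_liftSset_eq, fun f _ g _ h => ?_,
    fun f _ g _ => eq_of_forall_unitSset fun n => ?_,
    fun f _ g _ => eq_of_forall_unitSset fun n => ?_,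
    fun c f _ => eq_of_forall_unitSset fun n => ?_, fun f _ => norm_liftSset f⟩
  · ext n
    rw [← liftSset_unitSset, h, liftSset_unitSset]
  all_goals simp [liftSset_unitSset]
end
end

section
/- Let X be a Tychonoff (completely regular Hausdorff) space and let H be a non-vanishing closed ideal of C_B(X). Then λ_H X is σ-compact if and only if H is σ-generated, that is, there exist f_1, f_2, … in C_B(X) such that H equals the norm-closure of the ideal of C_B(X) generated by {f_1, f_2, …}. -/
open Set Filter Topology BoundedContinuousFunction

noncomputable section

/-- The subspace `λ_H X = ⋃_{h ∈ H} cl_{βX} {x : |h x| > 1}` of `βX`. -/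
def lambdaH {X : Type*} [TopologicalSpace X] (H : Set (X →ᵇ ℂ)) : Set (StoneCech X) :=
  ⋃ h ∈ H, closure (stoneCechUnit '' {x : X | 1 < ‖h x‖})

namespace ContinuousMap

theorem setOfIdeal_span {K R : Type*} [TopologicalSpace K] [Semiring R] [TopologicalSpace R]
    [IsTopologicalSemiring R] (S : Set C(K, R)) :
    setOfIdeal (Ideal.span S) = ⋃ g ∈ S, {x | g x ≠ 0} := by
  apply Subset.antisymm
  · refine (ideal_gc K R _ _).2 (Ideal.span_le.2 fun g hg => mem_idealOfSet.2 fun x hx => ?_)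
    by_contra hgx
    exact hx (mem_biUnion hg hgx)
  · refine iUnion₂_subset fun g hg x hx => mem_setOfIdeal.2 ⟨g, Ideal.subset_span hg, hx⟩

variable {K 𝕜 : Type*} [TopologicalSpace K] [CompactSpace K] [RCLike 𝕜]

theorem eq_closure_iff_setOfIdeal_eq [T2Space K] {I J : Ideal C(K, 𝕜)}
    (hI : IsClosed (I : Set C(K, 𝕜))) :
    I = J.closure ↔ setOfIdeal I = setOfIdeal J := by
  rw [← idealOfSet_ofIdeal_eq_closure]
  constructor
  · rintro h
    rw [h, setOfIdeal_ofSet_of_isOpen _ (setOfIdeal_open J)]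
  · intro h
    rw [← h, idealOfSet_ofIdeal_isClosed hI]

theorem isSigmaCompact_ne_zero (g : C(K, 𝕜)) : IsSigmaCompact {x | g x ≠ 0} := by
  have h : {x | g x ≠ 0} = ⋃ n : ℕ, {x | 1 / ((n : ℝ) + 1) ≤ ‖g x‖} := by
    ext x
    simp only [mem_ofPred_eq, mem_iUnion]
    constructor
    · intro hx
      obtain ⟨n, hn⟩ := exists_nat_one_div_lt (norm_pos_iff.2 hx)
      exact ⟨n, hn.le⟩
    · rintro ⟨n, hn⟩
      exact norm_pos_iff.1 (Nat.one_div_pos_of_nat.trans_le hn)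
  rw [h]
  exact isSigmaCompact_iUnion_of_isCompact _ fun n =>
    (isClosed_le continuous_const g.continuous.norm).isCompact

theorem isSigmaCompact_setOfIdeal_iff [T2Space K] {I : Ideal C(K, 𝕜)}
    (hI : IsClosed (I : Set C(K, 𝕜))) :
    IsSigmaCompact (setOfIdeal I) ↔
      ∃ f : ℕ → C(K, 𝕜), I = (Ideal.span (range f)).closure := by
  simp only [eq_closure_iff_setOfIdeal_eq hI, setOfIdeal_span, biUnion_range]
  constructor
  · intro h
    obtain ⟨T, hTc, hTI, hT⟩ : ∃ T : Set C(K, 𝕜), T.Countable ∧ T ⊆ I ∧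
        setOfIdeal I ⊆ ⋃ g ∈ T, {x | g x ≠ 0} := by
      obtain ⟨T, hTI, hTc, hT⟩ := h.isLindelof.elim_countable_subcover_image
        (b := (I : Set C(K, 𝕜))) (c := fun g => {x | g x ≠ 0})
        (fun g _ => isOpen_ne_fun g.continuous continuous_const) fun x hx => by
          obtain ⟨g, hg, hgx⟩ := mem_setOfIdeal.1 hx
          exact mem_biUnion hg hgx
      exact ⟨T, hTc, hTI, hT⟩
    obtain ⟨f, hf⟩ := (hTc.insert 0).exists_eq_range (insert_nonempty 0 T)
    refine ⟨f, Subset.antisymm (fun x hx => ?_) (iUnion_subset fun n x hx => ?_)⟩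
    · obtain ⟨g, hg, hgx⟩ := mem_iUnion₂.1 (hT hx)
      obtain ⟨n, rfl⟩ : g ∈ range f := hf ▸ mem_insert_of_mem 0 hg
      exact mem_iUnion.2 ⟨n, hgx⟩
    · have hn : f n ∈ insert 0 T := hf ▸ mem_range_self n
      refine mem_setOfIdeal.2 ⟨f n, ?_, hx⟩
      rcases hn with hn | hn
      · rw [hn]
        exact I.zero_mem
      · exact hTI hn
  · rintro ⟨f, hf⟩
    rw [hf]
    exact isSigmaCompact_iUnion _ fun n => isSigmaCompact_ne_zero (f n)

end ContinuousMap

section StoneCech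

variable {X : Type*} [TopologicalSpace X]

/-- Restriction of continuous functions from `βX` to `X`. -/
def stoneCechRestrict (X : Type*) [TopologicalSpace X] : C(StoneCech X, ℂ) →+* (X →ᵇ ℂ) where
  toFun g := (mkOfCompact g).compContinuous ⟨stoneCechUnit, continuous_stoneCechUnit⟩
  map_one' := rfl
  map_mul' _ _ := rfl
  map_zero' := rfl
  map_add' _ _ := rfl

@[simp]
theorem stoneCechRestrict_apply (g : C(StoneCech X, ℂ)) (x : X) :
    stoneCechRestrict X g x = g (stoneCechUnit x) := rfl

theorem isometry_stoneCechRestrict : Isometry (stoneCechRestrict X) := by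
  refine AddMonoidHomClass.isometry_of_norm _ fun g => le_antisymm ?_ ?_
  · exact (BoundedContinuousFunction.norm_le (norm_nonneg g)).2 fun x => g.norm_coe_le_norm _
  · refine (ContinuousMap.norm_le g (norm_nonneg _)).2 fun p => ?_
    refine denseRange_stoneCechUnit.induction_on p
      (isClosed_le g.continuous.norm continuous_const) fun x => ?_
    exact (stoneCechRestrict X g).norm_coe_le_norm x

theorem surjective_stoneCechRestrict : Function.Surjective (stoneCechRestrict X) := by
  intro f
  let φ : X → Metric.closedBall (0 : ℂ) ‖f‖ :=
    fun x => ⟨f x, mem_closedBall_zero_iff.2 (f.norm_coe_le_norm x)⟩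
  have hφ : Continuous φ := f.continuous.subtype_mk _
  have : CompactSpace (Metric.closedBall (0 : ℂ) ‖f‖) :=
    isCompact_iff_compactSpace.1 (isCompact_closedBall 0 ‖f‖)
  refine ⟨⟨fun p => (stoneCechExtend hφ p : Metric.closedBall (0 : ℂ) ‖f‖),
    continuous_subtype_val.comp (continuous_stoneCechExtend hφ)⟩, ?_⟩
  ext x
  simp [φ]

/-- The isomorphism between `C(βX, ℂ)` and the algebra of bounded continuous functions on `X`. -/
def stoneCechRingEquiv (X : Type*) [TopologicalSpace X] : C(StoneCech X, ℂ) ≃+* (X →ᵇ ℂ) :=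
  RingEquiv.ofBijective (stoneCechRestrict X)
    ⟨isometry_stoneCechRestrict.injective, surjective_stoneCechRestrict⟩

/-- `stoneCechRingEquiv` as a homeomorphism. -/
def stoneCechHomeomorph (X : Type*) [TopologicalSpace X] : C(StoneCech X, ℂ) ≃ₜ (X →ᵇ ℂ) :=
  (IsometryEquiv.mk (stoneCechRingEquiv X).toEquiv isometry_stoneCechRestrict).toHomeomorph

theorem lambdaH_eq_setOfIdeal (H : Ideal (X →ᵇ ℂ)) :
    lambdaH (H : Set (X →ᵇ ℂ)) =
      ContinuousMap.setOfIdeal (H.comap (stoneCechRestrict X)) := by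
  ext p
  simp only [lambdaH, mem_iUnion, ContinuousMap.mem_setOfIdeal, Ideal.mem_comap, SetLike.mem_coe,
    exists_prop]
  constructor
  · rintro ⟨h, hH, hp⟩
    obtain ⟨g, rfl⟩ := surjective_stoneCechRestrict h
    refine ⟨g, hH, fun hgp => ?_⟩
    have hle : 1 ≤ ‖g p‖ := by
      refine closure_minimal (t := {q | 1 ≤ ‖g q‖}) ?_
        (isClosed_le continuous_const g.continuous.norm) hp
      rintro _ ⟨x, hx, rfl⟩
      exact (show 1 < ‖g (stoneCechUnit x)‖ from hx).le
    rw [hgp, norm_zero] at hle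
    exact absurd hle (by norm_num)
  · rintro ⟨g, hg, hgp⟩
    let k : C(StoneCech X, ℂ) := ContinuousMap.const _ (2 / g p) * g
    have hk : k p = 2 := div_mul_cancel₀ _ hgp
    refine ⟨stoneCechRestrict X k, ?_, ?_⟩
    · rw [map_mul]
      exact H.mul_mem_left _ hg
    · have hopen : IsOpen {q | 1 < ‖k q‖} := isOpen_lt continuous_const k.continuous.norm
      have hp : p ∈ {q | 1 < ‖k q‖} := by simp [hk]
      have := denseRange_stoneCechUnit.open_subset_closure_inter hopen hp
      refine closure_mono ?_ this
      rintro _ ⟨hq, x, rfl⟩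
      exact ⟨x, hq, rfl⟩

theorem eq_closure_span_iff_comap (H : Ideal (X →ᵇ ℂ)) (f : ℕ → C(StoneCech X, ℂ)) :
    (H : Set (X →ᵇ ℂ)) = closure (Ideal.span (range (stoneCechRestrict X ∘ f)) : Set (X →ᵇ ℂ)) ↔
      H.comap (stoneCechRestrict X) = (Ideal.span (range f)).closure := by
  have himage : (Ideal.span (range (stoneCechRestrict X ∘ f)) : Set (X →ᵇ ℂ)) =
      stoneCechHomeomorph X '' (Ideal.span (range f) : Set C(StoneCech X, ℂ)) := by
    rw [range_comp, ← Ideal.map_span]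
    ext h
    exact Ideal.mem_map_iff_of_surjective _ surjective_stoneCechRestrict
  have hH : (H : Set (X →ᵇ ℂ)) =
      stoneCechHomeomorph X '' (H.comap (stoneCechRestrict X) : Set C(StoneCech X, ℂ)) :=
    (image_preimage_eq _ surjective_stoneCechRestrict).symm
  rw [himage, ← (stoneCechHomeomorph X).image_closure, hH,
    (stoneCechHomeomorph X).injective.image_injective.eq_iff, ← Ideal.coe_closure,
    SetLike.coe_set_eq]

end StoneCech

theorem stmt_8 {X : Type*} [TopologicalSpace X] [T35Space X]
    (H : Ideal (X →ᵇ ℂ)) (hclosed : IsClosed (H : Set (X →ᵇ ℂ)))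
    (hnv : ∀ x : X, ∃ h ∈ H, h x ≠ 0) :
    IsSigmaCompact (lambdaH (H : Set (X →ᵇ ℂ))) ↔
      ∃ f : ℕ → (X →ᵇ ℂ),
        (H : Set (X →ᵇ ℂ)) = closure (Ideal.span (Set.range f) : Set (X →ᵇ ℂ)) := by
  have hI : IsClosed (H.comap (stoneCechRestrict X) : Set C(StoneCech X, ℂ)) :=
    hclosed.preimage isometry_stoneCechRestrict.continuous
  rw [lambdaH_eq_setOfIdeal, ContinuousMap.isSigmaCompact_setOfIdeal_iff hI,
    surjective_stoneCechRestrict.comp_left.exists]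
  simp only [eq_closure_span_iff_comap]
end
end
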